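/- For every n ≥ 3 there exists a 2-CNF formula φ such that AtMostOne(x_1, …, x_n) ⊢* φ and |φ| = 3n − 6. -/

import Mathlib

namespace BVAPaper

/-- A literal is a propositional variable (a natural number) together with a
polarity: `true` for a positive literal, `false` for a negative one. -/
abbrev Lit := ℕ × Bool

/-- A clause is a finite set of literals (required to be pairwise
non-complementary via `IsClause`). -/
abbrev Clause := Finset Lit

/-- A formula is a finite set of clauses; its size is its number of clauses. -/
abbrev Formula := Finset Clause

/-- A genuine clause: it contains no pair of complementary literals. -/
def IsClause (C : Clause) : Prop := ∀ v : ℕ, ¬ ((v, true) ∈ C ∧ (v, false) ∈ C)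

/-- A 2-CNF formula: every member is a genuine clause with exactly two literals. -/
def Is2CNF (φ : Formula) : Prop := ∀ C ∈ φ, IsClause C ∧ C.card = 2

/-- The set of variables occurring in a formula. -/
def Vars (φ : Formula) : Finset ℕ := φ.biUnion (fun C => C.image Prod.fst)

/-- A literal is true under an assignment. -/
def LitTrue (τ : ℕ → Bool) (l : Lit) : Prop := τ l.1 = l.2

/-- An assignment satisfies a formula if it makes some literal of every clause true. -/
def Satisfies (τ : ℕ → Bool) (φ : Formula) : Prop := ∀ C ∈ φ, ∃ l ∈ C, LitTrue τ l

/-- `φ` semantically implies the equivalence of the literals `l₁` and `l₂`. -/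
def ImpliesEquiv (φ : Formula) (l₁ l₂ : Lit) : Prop :=
  ∀ τ : ℕ → Bool, Satisfies τ φ → (LitTrue τ l₁ ↔ LitTrue τ l₂)

/-- A simple 2-CNF formula: (a) no two distinct literals are implied equivalent,
(b) every clause contains a negative literal, (c) no two distinct clauses are over
the same pair of variables. -/
def IsSimple (φ : Formula) : Prop :=
  (∀ l₁ l₂ : Lit, l₁ ≠ l₂ → ¬ ImpliesEquiv φ l₁ l₂) ∧
  (∀ C ∈ φ, ∃ l ∈ C, l.2 = false) ∧
  (∀ C₁ ∈ φ, ∀ C₂ ∈ φ, C₁.image Prod.fst = C₂.image Prod.fst → C₁ = C₂)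

/-- A monotone formula: every literal occurring in it is positive. -/
def MonotoneFormula (φ : Formula) : Prop := ∀ C ∈ φ, ∀ l ∈ C, l.2 = true

/-- `𝒞 ⋈ 𝒟`: the set of clauses `C ∪ D` for `C ∈ 𝒞` and `D ∈ 𝒟`. -/
def JoinClauses (𝒞 𝒟 : Finset Clause) : Finset Clause :=
  (𝒞 ×ˢ 𝒟).image (fun p => p.1 ∪ p.2)

/-- One BVA step. -/
def BVAStep (φ φ' : Formula) : Prop :=
  ∃ (𝒞 𝒟 : Finset Clause) (y : ℕ),
    (∀ C ∈ 𝒞, IsClause C ∧ C.Nonempty) ∧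
    (∀ D ∈ 𝒟, IsClause D ∧ D.Nonempty) ∧
    JoinClauses 𝒞 𝒟 ⊆ φ ∧
    y ∉ Vars φ ∧
    φ' = (φ \ JoinClauses 𝒞 𝒟)
      ∪ 𝒞.image (fun C => insert ((y, true) : Lit) C)
      ∪ 𝒟.image (fun D => insert ((y, false) : Lit) D)

/-- Idealized BVA: the reflexive transitive closure of single BVA steps. -/
def BVAChain : Formula → Formula → Prop := Relation.ReflTransGen BVAStep

/-- Negate the variables from `S` inside a literal. -/
def flipLit (S : Finset ℕ) (l : Lit) : Lit := if l.1 ∈ S then (l.1, !l.2) else l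

/-- Negate the variables from `S` throughout a formula. -/
def flipFormula (S : Finset ℕ) (φ : Formula) : Formula :=
  φ.image (fun C => C.image (flipLit S))

/-- `φ ≅_W φ'`: `φ'` is obtained from `φ` by replacing some variables from `W`
by their negations wherever they appear. -/
def EquivW (W : Finset ℕ) (φ φ' : Formula) : Prop :=
  ∃ S ⊆ W, φ' = flipFormula S φ

/-- `φ'` encodes `φ` over the base variables `X`: for every assignment `τ` of `X`,
`τ` satisfies `φ` iff `τ` extends to a satisfying assignment of `φ'`. -/
def Encodes (φ' φ : Formula) (X : Finset ℕ) : Prop :=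
  ∀ τ : ℕ → Bool,
    Satisfies τ φ ↔ ∃ σ : ℕ → Bool, (∀ x ∈ X, σ x = τ x) ∧ Satisfies σ φ'

/-- The direct encoding of the at-most-one constraint on the variables `0, …, n-1`. -/
def atMostOne (n : ℕ) : Formula :=
  (((Finset.range n) ×ˢ (Finset.range n)).filter (fun p => p.1 < p.2)).image
    (fun p => ({(p.1, false), (p.2, false)} : Clause))

/-- A diagram: a graph with both undirected edges (represented as a symmetric
set of ordered pairs) and directed edges. -/
structure Diagram where
  verts : Finset ℕ
  undir : Finset (ℕ × ℕ)
  dir : Finset (ℕ × ℕ)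

/-- Well-formedness of a diagram: no loops, edges between vertices, the
undirected edge set is symmetric, and at most one edge between any two vertices. -/
def Diagram.WF (G : Diagram) : Prop :=
  (∀ e ∈ G.undir, e.1 ∈ G.verts ∧ e.2 ∈ G.verts ∧ e.1 ≠ e.2) ∧
  (∀ e ∈ G.dir, e.1 ∈ G.verts ∧ e.2 ∈ G.verts ∧ e.1 ≠ e.2) ∧
  (∀ u v : ℕ, (u, v) ∈ G.undir → (v, u) ∈ G.undir) ∧
  (∀ u v : ℕ, (u, v) ∈ G.undir → (u, v) ∉ G.dir ∧ (v, u) ∉ G.dir) ∧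
  (∀ u v : ℕ, (u, v) ∈ G.dir → (v, u) ∉ G.dir)

/-- The complete diagram `K_n` on vertices `0, …, n-1`: all edges undirected. -/
def completeDiagram (n : ℕ) : Diagram where
  verts := Finset.range n
  undir := ((Finset.range n) ×ˢ (Finset.range n)).filter (fun p => p.1 ≠ p.2)
  dir := ∅

/-- The diagram associated to a simple 2-CNF formula: an undirected edge
`{x, y}` for each clause `(¬x ∨ ¬y)` and a directed edge `(x, y)` for each
clause `(¬x ∨ y)`. -/
def diagramOf (φ : Formula) : Diagram where
  verts := Vars φ
  undir := ((Vars φ) ×ˢ (Vars φ)).filter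
    (fun p => ({(p.1, false), (p.2, false)} : Clause) ∈ φ)
  dir := ((Vars φ) ×ˢ (Vars φ)).filter
    (fun p => ({(p.1, false), (p.2, true)} : Clause) ∈ φ)

/-- A polarized diagram: a directed graph with a polarity on its edges
(`true` = `+`, `false` = `−`). -/
structure PolDiagram where
  verts : Finset ℕ
  edges : Finset (ℕ × ℕ)
  pol : ℕ × ℕ → Bool

/-- `(P, P.pol)` is a polarized diagram of the diagram `G`: every undirected
edge of `G` is oriented (in exactly one way) with polarity `−`, and every
directed edge of `G` is kept with polarity `+`. -/
def IsPolarizationOf (P : PolDiagram) (G : Diagram) : Prop :=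
  P.verts = G.verts ∧
  (∀ u v : ℕ, (u, v) ∈ G.dir ↔ ((u, v) ∈ P.edges ∧ P.pol (u, v) = true)) ∧
  (∀ u v : ℕ, (u, v) ∈ G.undir ↔
    (((u, v) ∈ P.edges ∧ P.pol (u, v) = false) ∨
     ((v, u) ∈ P.edges ∧ P.pol (v, u) = false))) ∧
  (∀ u v : ℕ, ¬ ((u, v) ∈ P.edges ∧ (v, u) ∈ P.edges))

/-- A polarized rectifier network: base vertices, auxiliary vertices, directed
edges, and a polarity function (only meaningful on edges into base vertices). -/
structure PRN where
  base : Finset ℕ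
  aux : Finset ℕ
  edges : Finset (ℕ × ℕ)
  pol : ℕ × ℕ → Bool

/-- Well-formedness of a PRN: base and auxiliary vertices are disjoint, and
edges are loopless edges between vertices. -/
def PRN.WF (R : PRN) : Prop :=
  Disjoint R.base R.aux ∧
  (∀ e ∈ R.edges, e.1 ∈ R.base ∪ R.aux ∧ e.2 ∈ R.base ∪ R.aux ∧ e.1 ≠ e.2)

/-- A valid walk from the base vertex `u` to the base vertex `v`: a sequence of
length ≥ 2 of consecutive edges whose interior vertices are auxiliary. -/
def ValidWalk (R : PRN) (u v : ℕ) (π : List ℕ) : Prop :=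
  2 ≤ π.length ∧
  π.head? = some u ∧ π.getLast? = some v ∧
  u ∈ R.base ∧ v ∈ R.base ∧
  List.Chain' (fun a b => (a, b) ∈ R.edges) π ∧
  (∀ i : ℕ, 0 < i → i + 1 < π.length → π.getD i 0 ∈ R.aux)

/-- The polarity of a walk: the polarity of its last edge. -/
def walkPol (R : PRN) (π : List ℕ) : Bool :=
  R.pol (π.getD (π.length - 2) 0, π.getD (π.length - 1) 0)

/-- A strict polarized rectifier network: (1) for distinct base vertices `u, v`
there is at most one valid walk from `u` to `v` or from `v` to `u` in total, and
(2) every auxiliary vertex belongs to some valid walk. -/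
def IsSPRN (R : PRN) : Prop :=
  (∀ u ∈ R.base, ∀ v ∈ R.base, u ≠ v →
    ∀ π₁ π₂ : List ℕ,
      (ValidWalk R u v π₁ ∨ ValidWalk R v u π₁) →
      (ValidWalk R u v π₂ ∨ ValidWalk R v u π₂) → π₁ = π₂) ∧
  (∀ a ∈ R.aux, ∃ u v : ℕ, ∃ π : List ℕ, ValidWalk R u v π ∧ a ∈ π)

/-- The PRN `R` realizes the polarized diagram `P`. -/
def RealizesPol (R : PRN) (P : PolDiagram) : Prop :=
  R.base = P.verts ∧
  ∀ u ∈ P.verts, ∀ v ∈ P.verts,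
    ((u, v) ∈ P.edges ↔ ∃ π : List ℕ, ValidWalk R u v π ∧ walkPol R π = P.pol (u, v))

/-- The PRN `R` realizes the diagram `G`: it realizes some polarized diagram of `G`. -/
def RealizesDiagram (R : PRN) (G : Diagram) : Prop :=
  ∃ P : PolDiagram, IsPolarizationOf P G ∧ RealizesPol R P

/-- The 2-CNF formula `F_R` associated to a PRN `R`. -/
def PRN.formula (R : PRN) : Formula :=
  R.edges.image (fun e =>
    if e.2 ∈ R.base ∧ R.pol e = false
    then ({(e.1, false), (e.2, false)} : Clause)
    else ({(e.1, false), (e.2, true)} : Clause))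

/-- The PRN associated to a polarized diagram (no auxiliary vertices). -/
def prnOfPol (P : PolDiagram) : PRN :=
  ⟨P.verts, ∅, P.edges, P.pol⟩

/-- A coherent biclique `(X, Y)` of a PRN. -/
def CoherentBiclique (R : PRN) (X Y : Finset ℕ) : Prop :=
  X.Nonempty ∧ Y.Nonempty ∧ Disjoint X Y ∧
  X ⊆ R.base ∪ R.aux ∧ Y ⊆ R.base ∪ R.aux ∧
  (∀ x ∈ X, ∀ y ∈ Y, (x, y) ∈ R.edges) ∧
  (∀ y ∈ Y, y ∈ R.base → ∀ x₁ ∈ X, ∀ x₂ ∈ X, R.pol (x₁, y) = R.pol (x₂, y))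

/-- `R'` is the biclique reduction of `R` with respect to some coherent biclique. -/
def BicliqueStep (R R' : PRN) : Prop :=
  ∃ (X Y : Finset ℕ) (z : ℕ),
    CoherentBiclique R X Y ∧
    z ∉ R.base ∪ R.aux ∧
    R'.base = R.base ∧
    R'.aux = insert z R.aux ∧
    R'.edges = (R.edges \ (X ×ˢ Y)) ∪ (X ×ˢ ({z} : Finset ℕ)) ∪ (({z} : Finset ℕ) ×ˢ Y) ∧
    (∀ y ∈ Y, y ∈ R.base → ∀ x ∈ X, R'.pol (z, y) = R.pol (x, y)) ∧
    (∀ e ∈ R.edges \ (X ×ˢ Y), e.2 ∈ R.base → R'.pol e = R.pol e)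

/-- `R ↪* R'`: the reflexive transitive closure of biclique reduction. -/
def BicliqueChain : PRN → PRN → Prop := Relation.ReflTransGen BicliqueStep

/-- The total degree (in-degree plus out-degree) of a vertex in a PRN. -/
def totalDeg (R : PRN) (v : ℕ) : ℕ :=
  (R.edges.filter (fun e => e.1 = v)).card + (R.edges.filter (fun e => e.2 = v)).card

/-- The clause `(¬a ∨ ¬b)`. -/
def negPair (a b : ℕ) : Clause := {(a, false), (b, false)}

/-- The direct encoding of the at-most-one constraint on an arbitrary set of variables. -/
def amoOn (S : Finset ℕ) : Formula :=
  (S.powersetCard 2).image (fun T => T.image (fun v => ((v, false) : Lit)))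

theorem mem_negPair {a b : ℕ} {l : Lit} : l ∈ negPair a b ↔ l = (a, false) ∨ l = (b, false) := by
  simp [negPair]

theorem mem_amoOn {S : Finset ℕ} {C : Clause} :
    C ∈ amoOn S ↔ ∃ a ∈ S, ∃ b ∈ S, a ≠ b ∧ C = negPair a b := by
  simp only [amoOn, Finset.mem_image, Finset.mem_powersetCard, Finset.card_eq_two]
  constructor
  · rintro ⟨T, ⟨hT, a, b, hab, rfl⟩, rfl⟩
    exact ⟨a, hT (by simp), b, hT (by simp), hab, by simp [negPair]⟩
  · rintro ⟨a, ha, b, hb, hab, rfl⟩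
    exact ⟨{a, b}, ⟨by simp [Finset.insert_subset_iff, ha, hb], a, b, hab, rfl⟩,
      by simp [negPair]⟩

theorem card_amoOn (S : Finset ℕ) : (amoOn S).card = S.card.choose 2 := by
  rw [amoOn, Finset.card_image_of_injective, Finset.card_powersetCard]
  exact Finset.image_injective fun a b h => by simpa using h

theorem mem_of_mem_amoOn {S : Finset ℕ} {C : Clause} (hC : C ∈ amoOn S) {l : Lit} (hl : l ∈ C) :
    l.1 ∈ S := by
  obtain ⟨a, ha, b, hb, -, rfl⟩ := mem_amoOn.1 hC
  rcases mem_negPair.1 hl with rfl | rfl <;> assumption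

theorem atMostOne_eq_amoOn (n : ℕ) : atMostOne n = amoOn (Finset.range n) := by
  ext C
  simp only [atMostOne, mem_amoOn, Finset.mem_image, Finset.mem_filter, Finset.mem_product,
    Finset.mem_range, Prod.exists]
  constructor
  · rintro ⟨a, b, ⟨⟨ha, hb⟩, hab⟩, rfl⟩
    exact ⟨a, ha, b, hb, hab.ne, rfl⟩
  · rintro ⟨a, ha, b, hb, hab, rfl⟩
    rcases hab.lt_or_gt with h | h
    · exact ⟨a, b, ⟨⟨ha, hb⟩, h⟩, rfl⟩
    · exact ⟨b, a, ⟨⟨hb, ha⟩, h⟩, Finset.pair_comm _ _⟩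

theorem amoOn_insert {a : ℕ} {R : Finset ℕ} (ha : a ∉ R) :
    amoOn (insert a R) = R.image (negPair a) ∪ amoOn R := by
  ext C
  simp only [mem_amoOn, Finset.mem_union, Finset.mem_image, Finset.mem_insert]
  constructor
  · rintro ⟨u, rfl | hu, v, rfl | hv, huv, rfl⟩
    · exact absurd rfl huv
    · exact .inl ⟨v, hv, rfl⟩
    · exact .inl ⟨u, hu, Finset.pair_comm _ _⟩
    · exact .inr ⟨u, hu, v, hv, huv, rfl⟩
  · rintro (⟨r, hr, rfl⟩ | ⟨u, hu, v, hv, huv, rfl⟩)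
    · exact ⟨a, .inl rfl, r, .inr hr, fun h => ha (h ▸ hr), rfl⟩
    · exact ⟨u, .inr hu, v, .inr hv, huv, rfl⟩

theorem isClause_card_pair {l m : Lit} (h : l.1 ≠ m.1) :
    IsClause {l, m} ∧ ({l, m} : Clause).card = 2 := by
  refine ⟨fun v => ?_, Finset.card_pair fun e => h (e ▸ rfl)⟩
  simp only [Finset.mem_insert, Finset.mem_singleton]
  rintro ⟨rfl | rfl, h' | h'⟩ <;> simp_all [Prod.ext_iff]

theorem is2CNF_amoOn (S : Finset ℕ) : Is2CNF (amoOn S) := by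
  intro C hC
  obtain ⟨a, -, b, -, hab, rfl⟩ := mem_amoOn.1 hC
  exact isClause_card_pair hab

/-- The three clauses that remain after `a` and `b` have been merged into `y`. -/
def mergeClauses (a b y : ℕ) : Formula :=
  {negPair a b, {(y, true), (a, false)}, {(y, true), (b, false)}}

theorem is2CNF_mergeClauses {a b y : ℕ} (hab : a ≠ b) (hya : y ≠ a) (hyb : y ≠ b) :
    Is2CNF (mergeClauses a b y) := by
  intro C hC
  simp only [mergeClauses, Finset.mem_insert, Finset.mem_singleton] at hC
  rcases hC with rfl | rfl | rfl
  exacts [isClause_card_pair hab, isClause_card_pair hya, isClause_card_pair hyb]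

theorem card_mergeClauses {a b y : ℕ} (hab : a ≠ b) : (mergeClauses a b y).card = 3 := by
  have hm : ((y, true) : Lit) ∉ negPair a b := by simp [negPair]
  have hne {l : Lit} : negPair a b ≠ {(y, true), l} := fun h => hm (h ▸ by simp)
  refine Finset.card_eq_three.2 ⟨_, _, _, hne, hne, fun h => ?_, rfl⟩
  have : ((a, false) : Lit) ∈ ({(y, true), (b, false)} : Clause) := h ▸ by simp
  simp [hab] at this

theorem mem_or_mem_of_mem_mergeClauses {a b y : ℕ} {C : Clause} (hC : C ∈ mergeClauses a b y) :
    (a, false) ∈ C ∨ (b, false) ∈ C := by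
  simp only [mergeClauses, Finset.mem_insert, Finset.mem_singleton] at hC
  rcases hC with rfl | rfl | rfl <;> simp [negPair]

theorem bvaStep_merge {ψ : Formula} {R : Finset ℕ} {a b y : ℕ}
    (hab : a ≠ b) (ha : a ∉ R) (hb : b ∉ R)
    (hψ : Disjoint ψ (amoOn (insert a (insert b R))))
    (hy : y ∉ Vars (ψ ∪ amoOn (insert a (insert b R)))) (hyR : y ∉ R) :
    BVAStep (ψ ∪ amoOn (insert a (insert b R)))
      ((ψ ∪ mergeClauses a b y) ∪ amoOn (insert y R)) := by
  have hsing (l : Lit) : IsClause {l} ∧ ({l} : Clause).Nonempty :=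
    ⟨fun v => by rcases l with ⟨_, _ | _⟩ <;> simp, by simp⟩
  have hJ : JoinClauses {{(a, false)}, {(b, false)}} (R.image fun r => {(r, false)}) =
      R.image (negPair a) ∪ R.image (negPair b) := by
    ext C
    simp only [JoinClauses, negPair, Finset.mem_image, Finset.mem_product, Finset.mem_insert,
      Finset.mem_singleton, Finset.mem_union, Prod.exists]
    constructor
    · rintro ⟨_, _, ⟨rfl | rfl, r, hr, rfl⟩, rfl⟩
      exacts [.inl ⟨r, hr, rfl⟩, .inr ⟨r, hr, rfl⟩]
    · rintro (⟨r, hr, rfl⟩ | ⟨r, hr, rfl⟩)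
      exacts [⟨_, _, ⟨.inl rfl, r, hr, rfl⟩, rfl⟩, ⟨_, _, ⟨.inr rfl, r, hr, rfl⟩, rfl⟩]
  have haR : a ∉ insert b R := by simp [hab, ha]
  have hsplit : amoOn (insert a (insert b R)) =
      {negPair a b} ∪ (R.image (negPair a) ∪ R.image (negPair b)) ∪ amoOn R := by
    rw [amoOn_insert haR, amoOn_insert hb, Finset.image_insert, Finset.insert_eq]
    simp only [Finset.union_assoc]
  have hrest : Disjoint (ψ ∪ ({negPair a b} ∪ amoOn R))
      (R.image (negPair a) ∪ R.image (negPair b)) := by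
    rw [Finset.disjoint_union_left]
    refine ⟨hψ.mono_right (hsplit ▸ fun C hC => by simp only [Finset.mem_union] at hC ⊢; tauto), ?_⟩
    rw [Finset.disjoint_left]
    intro C hC hC'
    obtain ⟨r, hr, hCr⟩ : ∃ r ∈ R, C = negPair a r ∨ C = negPair b r := by
      simp only [Finset.mem_union, Finset.mem_image] at hC'
      rcases hC' with ⟨r, hr, rfl⟩ | ⟨r, hr, rfl⟩
      exacts [⟨r, hr, .inl rfl⟩, ⟨r, hr, .inr rfl⟩]
    rcases Finset.mem_union.1 hC with h | h
    · have hrC : ((r, false) : Lit) ∈ negPair a b := by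
        rw [← Finset.mem_singleton.1 h]
        rcases hCr with rfl | rfl <;> simp [negPair]
      rcases mem_negPair.1 hrC with e | e <;> simp_all
    · rcases hCr with rfl | rfl
      · exact ha (mem_of_mem_amoOn h (mem_negPair.2 (.inl rfl)))
      · exact hb (mem_of_mem_amoOn h (mem_negPair.2 (.inl rfl)))
  refine ⟨{{(a, false)}, {(b, false)}}, R.image fun r => {(r, false)}, y, ?_, ?_, ?_, hy, ?_⟩
  · simp only [Finset.mem_insert, Finset.mem_singleton]
    rintro C (rfl | rfl) <;> exact hsing _
  · simp only [Finset.mem_image]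
    rintro C ⟨r, -, rfl⟩
    exact hsing _
  · rw [hJ, hsplit]
    intro C hC
    simp only [Finset.mem_union] at hC ⊢
    tauto
  · have hcomm : ψ ∪ ({negPair a b} ∪ (R.image (negPair a) ∪ R.image (negPair b)) ∪ amoOn R) =
        (ψ ∪ ({negPair a b} ∪ amoOn R)) ∪ (R.image (negPair a) ∪ R.image (negPair b)) := by
      ext C
      simp only [Finset.mem_union]
      tauto
    rw [hJ, hsplit, hcomm, Finset.union_sdiff_cancel_right hrest, amoOn_insert hyR,
      Finset.image_image, Finset.image_insert, Finset.image_singleton]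
    have hcomp : ((fun D : Clause => insert ((y, false) : Lit) D) ∘ fun r => {(r, false)}) =
        negPair y := rfl
    rw [hcomp, mergeClauses]
    ext C
    simp only [Finset.mem_union, Finset.mem_insert, Finset.mem_singleton]
    tauto

theorem mem_vars_of_mem {φ : Formula} {C : Clause} {l : Lit} (hC : C ∈ φ) (hl : l ∈ C) :
    l.1 ∈ Vars φ :=
  Finset.mem_biUnion.2 ⟨C, hC, Finset.mem_image_of_mem _ hl⟩

theorem exists_bvaChain_amoOn (k : ℕ) : ∀ (S : Finset ℕ) (ψ : Formula), S.card = k + 3 →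
    Disjoint ψ (amoOn S) → Is2CNF ψ →
    ∃ φ : Formula, Is2CNF φ ∧ BVAChain (ψ ∪ amoOn S) φ ∧ φ.card = ψ.card + 3 * (k + 1) := by
  have is2CNF_union {φ₁ φ₂ : Formula} (h₁ : Is2CNF φ₁) (h₂ : Is2CNF φ₂) : Is2CNF (φ₁ ∪ φ₂) :=
    fun C hC => (Finset.mem_union.1 hC).elim (h₁ C) (h₂ C)
  induction k with
  | zero =>
    intro S ψ hS hψ h2
    refine ⟨_, is2CNF_union h2 (is2CNF_amoOn S), .refl, ?_⟩
    rw [Finset.card_union_of_disjoint hψ, card_amoOn, hS]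
    rfl
  | succ k ih =>
    intro S ψ hS hψ h2
    obtain ⟨a, T, haT, rfl, hT⟩ := Finset.card_eq_succ.1 hS
    obtain ⟨b, R, hb, rfl, hR⟩ := Finset.card_eq_succ.1 hT
    obtain ⟨hab, ha⟩ : a ≠ b ∧ a ∉ R := by simpa using haT
    obtain ⟨y, hy⟩ := Infinite.exists_notMem_finset
      (Vars (ψ ∪ amoOn (insert a (insert b R))) ∪ insert a (insert b R))
    simp only [Finset.mem_union, Finset.mem_insert, not_or] at hy
    obtain ⟨hyV, hya, hyb, hyR⟩ := hy
    have hψy {C : Clause} {l : Lit} (hC : C ∈ ψ) (hl : l ∈ C) : l.1 ≠ y := fun h =>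
      hyV (h ▸ mem_vars_of_mem (Finset.mem_union_left _ hC) hl)
    have hdisj : Disjoint (ψ ∪ mergeClauses a b y) (amoOn (insert y R)) := by
      rw [Finset.disjoint_union_left]
      constructor
      · rw [amoOn_insert hyR, Finset.disjoint_union_right]
        constructor
        · rw [Finset.disjoint_right]
          intro C hC hCψ
          obtain ⟨r, -, rfl⟩ := Finset.mem_image.1 hC
          exact hψy hCψ (mem_negPair.2 (.inl rfl)) rfl
        · refine hψ.mono_right ?_
          rw [amoOn_insert haT, amoOn_insert hb]
          exact Finset.subset_union_right.trans Finset.subset_union_right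
      · rw [Finset.disjoint_left]
        intro C hC hC'
        rcases mem_or_mem_of_mem_mergeClauses hC with h | h
        · exact (Finset.mem_insert.1 (mem_of_mem_amoOn hC' h)).elim (Ne.symm hya) ha
        · exact (Finset.mem_insert.1 (mem_of_mem_amoOn hC' h)).elim (Ne.symm hyb) hb
    have hψm : Disjoint ψ (mergeClauses a b y) := by
      rw [Finset.disjoint_left]
      intro C hC hC'
      simp only [mergeClauses, Finset.mem_insert, Finset.mem_singleton] at hC'
      rcases hC' with rfl | rfl | rfl
      · exact Finset.disjoint_left.1 hψ hC (mem_amoOn.2 ⟨a, by simp, b, by simp, hab, rfl⟩)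
      · exact hψy hC (l := (y, true)) (by simp) rfl
      · exact hψy hC (l := (y, true)) (by simp) rfl
    obtain ⟨φ, hφ, hchain, hcard⟩ := ih (insert y R) (ψ ∪ mergeClauses a b y)
      (by rw [Finset.card_insert_of_notMem hyR, hR]) hdisj
      (is2CNF_union h2 (is2CNF_mergeClauses hab hya hyb))
    refine ⟨φ, hφ, .head (bvaStep_merge hab ha hb hψ hyV hyR) hchain, ?_⟩
    rw [hcard, Finset.card_union_of_disjoint hψm, card_mergeClauses hab]
    ring

/-- idealized BVA can reencode AtMostOne into `3n - 6` clauses. -/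
theorem amo_upper (n : ℕ) (hn : 3 ≤ n) :
    ∃ φ : Formula, Is2CNF φ ∧ BVAChain (atMostOne n) φ ∧ φ.card = 3 * n - 6 := by
  obtain ⟨k, rfl⟩ := Nat.exists_eq_add_of_le' hn
  obtain ⟨φ, h2, hchain, hcard⟩ := exists_bvaChain_amoOn k (Finset.range (k + 3)) ∅ (by simp)
    (Finset.disjoint_empty_left _) (by simp [Is2CNF])
  refine ⟨φ, h2, ?_, ?_⟩
  · simpa [atMostOne_eq_amoOn] using hchain
  · simp only [hcard, Finset.card_empty]
    omega

end BVAPaper
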